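/- Let φ_i be the Hermite functions obtained by orthonormalizing the sequence {x^i e^{-x²/2}} in L²(ℝ), and K_N(x,y) = Σ_{i=0}^{N−1} φ_i(x) φ_i(y). Then for all fixed real x ≠ y, lim_{N→∞} (1/(2^{1/2} N^{1/6})) · K_N( x/(2^{1/2} N^{1/6}) + √(2N), y/(2^{1/2} N^{1/6}) + √(2N) ) = ( Ai(x) Ai'(y) − Ai'(x) Ai(y) ) / (x − y), the Airy kernel. -/

import Mathlib

open MeasureTheory Complex Filter Set

noncomputable section

/-- Physicists' Hermite polynomials. -/
def gueH : ℕ → Polynomial ℝ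
  | 0 => 1
  | n + 1 => Polynomial.C 2 * Polynomial.X * gueH n - Polynomial.derivative (gueH n)

lemma gueH_succ (n : ℕ) : gueH (n + 1) =
    Polynomial.C 2 * Polynomial.X * gueH n - Polynomial.derivative (gueH n) := rfl

lemma gueH_deriv (n : ℕ) : Polynomial.derivative (gueH (n + 1)) =
    Polynomial.C (2 * ((n : ℝ) + 1)) * gueH n := by
  induction n with
  | zero => simp [gueH]
  | succ n ih =>
    rw [gueH, Polynomial.derivative_sub, ih, Polynomial.derivative_mul, ih,
      Polynomial.derivative_mul, Polynomial.derivative_mul]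
    simp only [Polynomial.derivative_C, Polynomial.derivative_X]
    rw [gueH]
    simp only [map_mul, map_add, map_natCast, Nat.cast_add, Nat.cast_one, map_one]
    ring

lemma gueH_natDegree_le (n : ℕ) : (gueH n).natDegree ≤ n := by
  induction n with
  | zero => simp [gueH]
  | succ n ih =>
    rw [gueH]
    refine (Polynomial.natDegree_sub_le _ _).trans (max_le ?_ ?_)
    · refine Polynomial.natDegree_mul_le.trans ?_
      have : (Polynomial.C (2 : ℝ) * Polynomial.X).natDegree ≤ 1 :=
        (Polynomial.natDegree_C_mul_le _ _).trans Polynomial.natDegree_X_le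
      omega
    · have := Polynomial.natDegree_derivative_le (gueH n)
      omega

lemma gueH_coeff (n : ℕ) : (gueH n).coeff n = 2 ^ n := by
  induction n with
  | zero => simp [gueH]
  | succ n ih =>
    rw [gueH, Polynomial.coeff_sub, mul_assoc, Polynomial.coeff_C_mul, Polynomial.coeff_X_mul, ih,
      Polynomial.coeff_derivative, Polynomial.coeff_eq_zero_of_natDegree_lt]
    · ring
    · have := gueH_natDegree_le n
      omega

lemma gueH_CD (u v : ℝ) (N : ℕ) :
    (u - v) * ∑ i ∈ Finset.range N, (gueH i).eval u * (gueH i).eval v / (2 ^ i * (i.factorial : ℝ))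
    = ((gueH N).eval u * (Polynomial.derivative (gueH N)).eval v
      - (Polynomial.derivative (gueH N)).eval u * (gueH N).eval v)
      / (2 ^ (N + 1) * (N.factorial : ℝ)) := by
  induction N with
  | zero => simp [gueH]
  | succ N ih =>
    rw [Finset.sum_range_succ, mul_add, ih, gueH_deriv]
    rw [gueH]
    simp only [Polynomial.eval_sub, Polynomial.eval_mul, Polynomial.eval_C, Polynomial.eval_X]
    have h1 : (N.factorial : ℝ) ≠ 0 := by positivity
    have h2 : ((N : ℝ) + 1) ≠ 0 := by positivity
    rw [Nat.factorial_succ]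
    push_cast
    field_simp
    ring

lemma gue_integrable_pow (n : ℕ) (b : ℝ) (hb : 0 < b) :
    Integrable (fun t : ℝ => t ^ n * Real.exp (-b * t ^ 2)) := by
  have := integrable_rpow_mul_exp_neg_mul_sq hb (s := (n : ℝ)) (by
    have : (0 : ℝ) ≤ n := by positivity
    linarith)
  simpa using this

lemma gue_integrable_poly (q : Polynomial ℝ) :
    Integrable (fun t : ℝ => q.eval t * Real.exp (-t ^ 2)) := by
  induction q using Polynomial.induction_on' with
  | add p q hp hq =>
    have h := hp.add hq
    refine h.congr (Eventually.of_forall fun t => ?_)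
    simp [add_mul]
  | monomial n a =>
    have := (gue_integrable_pow n 1 one_pos).const_mul a
    simpa [mul_assoc] using this

/-- The Gaussian functional. -/
def gueL (q : Polynomial ℝ) : ℝ := ∫ t : ℝ, q.eval t * Real.exp (-t ^ 2)

lemma gueL_add (p q : Polynomial ℝ) : gueL (p + q) = gueL p + gueL q := by
  unfold gueL
  rw [← integral_add (gue_integrable_poly p) (gue_integrable_poly q)]
  simp [add_mul]

lemma gueL_C_mul (c : ℝ) (q : Polynomial ℝ) : gueL (Polynomial.C c * q) = c * gueL q := by
  unfold gueL
  rw [← integral_const_mul]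
  simp [mul_assoc]

lemma gueL_sub (p q : Polynomial ℝ) : gueL (p - q) = gueL p - gueL q := by
  have := gueL_add p (Polynomial.C (-1) * q)
  rw [gueL_C_mul] at this
  have e : p + Polynomial.C (-1) * q = p - q := by simp [sub_eq_add_neg]
  rw [e] at this
  linarith

lemma gueL_one : gueL 1 = Real.sqrt Real.pi := by
  have := integral_gaussian 1
  simpa [gueL] using this

lemma gueL_ibp (n : ℕ) (q : Polynomial ℝ) :
    gueL (gueH (n + 1) * q) = gueL (gueH n * Polynomial.derivative q) := by
  rw [← sub_eq_zero, ← neg_eq_zero, neg_sub, ← gueL_sub]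
  unfold gueL
  apply integral_eq_zero_of_hasDerivAt_of_integrable
    (f := fun t : ℝ => (gueH n * q).eval t * Real.exp (-t ^ 2)) _ (gue_integrable_poly _)
    (gue_integrable_poly _)
  intro t
  have h1 := (gueH n * q).hasDerivAt t
  have h2 : HasDerivAt (fun t : ℝ => Real.exp (-t ^ 2)) (Real.exp (-t ^ 2) * (-(2 * t))) t := by
    have := ((hasDerivAt_pow 2 t).neg).exp
    simpa using this
  refine (h1.mul h2).congr_deriv ?_
  rw [gueH_succ]
  simp only [Polynomial.derivative_mul, Polynomial.eval_sub, Polynomial.eval_mul,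
    Polynomial.eval_add, Polynomial.eval_C, Polynomial.eval_X]
  ring

lemma gueL_iter (n : ℕ) : ∀ q : Polynomial ℝ,
    gueL (gueH n * q) = gueL (Polynomial.derivative^[n] q) := by
  induction n with
  | zero => intro q; simp [gueH]
  | succ n ih =>
    intro q
    rw [gueL_ibp, ih, Function.iterate_succ_apply]

lemma gueH_iter (n : ℕ) : Polynomial.derivative^[n] (gueH n) =
    Polynomial.C (2 ^ n * (n.factorial : ℝ)) := by
  induction n with
  | zero => simp [gueH]
  | succ n ih =>
    rw [Function.iterate_succ_apply, gueH_deriv, Polynomial.iterate_derivative_C_mul, ih,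
      ← map_mul, Nat.factorial_succ]
    congr 1
    push_cast
    ring

lemma gueL_H_sq (n : ℕ) : gueL (gueH n * gueH n) =
    2 ^ n * (n.factorial : ℝ) * Real.sqrt Real.pi := by
  rw [gueL_iter, gueH_iter, ← mul_one (Polynomial.C _), gueL_C_mul, gueL_one]

lemma gueL_H_low (n : ℕ) (q : Polynomial ℝ) (hq : q.degree < n) : gueL (gueH n * q) = 0 := by
  rw [gueL_iter, Polynomial.iterate_derivative_eq_zero_of_degree_lt hq]
  simp [gueL]

lemma gueL_sq_eq_zero (q : Polynomial ℝ) (h : gueL (q * q) = 0) : q = 0 := by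
  unfold gueL at h
  rw [integral_eq_zero_iff_of_nonneg _ (gue_integrable_poly _)] at h
  · have hc : Continuous (fun t : ℝ => (q * q).eval t * Real.exp (-t ^ 2)) := by fun_prop
    have h2 := (Continuous.ae_eq_iff_eq volume hc continuous_const).1 h
    apply Polynomial.funext
    intro r
    have : (q * q).eval r * Real.exp (-r ^ 2) = 0 := congrFun h2 r
    simpa [Real.exp_ne_zero] using this
  · intro t
    simp only [Polynomial.eval_mul, Pi.zero_apply]
    have := mul_self_nonneg (q.eval t)
    positivity

lemma gue_low (p : ℕ → Polynomial ℝ) (hdeg : ∀ i, (p i).natDegree = i)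
    (hlead : ∀ i, 0 < (p i).leadingCoeff)
    (horth : ∀ i j, gueL (p i * p j) = if i = j then (1 : ℝ) else 0) (n : ℕ) :
    ∀ m, m ≤ n → ∀ q : Polynomial ℝ, q.degree < m → gueL (p n * q) = 0 := by
  intro m
  induction m with
  | zero =>
    intro _ q hq
    have : q = 0 := by
      rw [← Polynomial.degree_eq_bot]
      simpa using hq
    simp [this, gueL]
  | succ m ih =>
    intro hm q hq
    set c := q.coeff m / (p m).leadingCoeff with hc
    have hl := (hlead m).ne'
    have hpm : (p m).coeff m = (p m).leadingCoeff := by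
      rw [Polynomial.leadingCoeff, hdeg]
    have hd : (q - Polynomial.C c * p m).degree < m := by
      rw [Polynomial.degree_lt_iff_coeff_zero]
      intro k hk
      rw [Polynomial.coeff_sub, Polynomial.coeff_C_mul]
      rcases hk.eq_or_lt with rfl | hk
      · rw [hpm, hc]
        field_simp
        ring
      · rw [Polynomial.degree_lt_iff_coeff_zero] at hq
        rw [hq k hk, Polynomial.coeff_eq_zero_of_natDegree_lt (by rw [hdeg]; exact hk)]
        simp
    have h1 := ih (by omega) _ hd
    have h2 := horth n m
    rw [if_neg (by omega)] at h2
    rw [mul_sub, gueL_sub, mul_left_comm, gueL_C_mul, h2] at h1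
    linarith

lemma gue_identify (p : ℕ → Polynomial ℝ) (hdeg : ∀ i, (p i).natDegree = i)
    (hlead : ∀ i, 0 < (p i).leadingCoeff)
    (horth : ∀ i j, gueL (p i * p j) = if i = j then (1 : ℝ) else 0) (n : ℕ) (u v : ℝ) :
    (p n).eval u * (p n).eval v =
      (gueH n).eval u * (gueH n).eval v / (2 ^ n * (n.factorial : ℝ)) / Real.sqrt Real.pi := by
  set c := (p n).leadingCoeff / 2 ^ n with hc
  have hpn : (p n).coeff n = (p n).leadingCoeff := by
    rw [Polynomial.leadingCoeff, hdeg]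
  have hd : (p n - Polynomial.C c * gueH n).degree < n := by
    rw [Polynomial.degree_lt_iff_coeff_zero]
    intro k hk
    rw [Polynomial.coeff_sub, Polynomial.coeff_C_mul]
    rcases hk.eq_or_lt with rfl | hk
    · rw [hpn, gueH_coeff, hc]
      field_simp
      ring
    · rw [Polynomial.coeff_eq_zero_of_natDegree_lt (by rw [hdeg]; exact hk),
        Polynomial.coeff_eq_zero_of_natDegree_lt ((gueH_natDegree_le n).trans_lt hk)]
      simp
  have h0 : p n - Polynomial.C c * gueH n = 0 := by
    apply gueL_sq_eq_zero
    rw [sub_mul, gueL_sub, gue_low p hdeg hlead horth n n le_rfl _ hd, mul_assoc, gueL_C_mul,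
      gueL_H_low n _ hd]
    simp
  have h1 : p n = Polynomial.C c * gueH n := sub_eq_zero.1 h0
  have h2 := horth n n
  rw [if_pos rfl, h1] at h2
  have e : Polynomial.C c * gueH n * (Polynomial.C c * gueH n) =
    Polynomial.C (c * c) * (gueH n * gueH n) := by rw [map_mul]; ring
  rw [e, gueL_C_mul, gueL_H_sq] at h2
  rw [h1]
  simp only [Polynomial.eval_mul, Polynomial.eval_C]
  have hs : Real.sqrt Real.pi ≠ 0 := by positivity
  rw [div_div, eq_div_iff (by positivity)]
  linear_combination ((gueH n).eval u * (gueH n).eval v) * h2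

lemma gue_kernel (φ : ℕ → ℝ → ℝ) (p : ℕ → Polynomial ℝ)
    (hdeg : ∀ i, (p i).natDegree = i)
    (hlead : ∀ i, 0 < (p i).leadingCoeff)
    (hφ : ∀ i t, φ i t = (p i).eval t * Real.exp (-t ^ 2 / 2))
    (horth : ∀ i j, ∫ t : ℝ, φ i t * φ j t = if i = j then (1 : ℝ) else 0) (N : ℕ) (u v : ℝ) :
    (u - v) * ∑ i ∈ Finset.range N, φ i u * φ i v =
    ((gueH N).eval u * (Polynomial.derivative (gueH N)).eval v
      - (Polynomial.derivative (gueH N)).eval u * (gueH N).eval v)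
      / (2 ^ (N + 1) * (N.factorial : ℝ)) / Real.sqrt Real.pi *
      (Real.exp (-u ^ 2 / 2) * Real.exp (-v ^ 2 / 2)) := by
  have ho : ∀ i j, gueL (p i * p j) = if i = j then (1 : ℝ) else 0 := by
    intro i j
    rw [← horth i j, gueL]
    congr 1
    ext t
    rw [hφ, hφ, Polynomial.eval_mul, mul_mul_mul_comm, ← Real.exp_add]
    congr 2
    ring
  rw [← gueH_CD, Finset.mul_sum, Finset.mul_sum, Finset.sum_div, Finset.sum_mul]
  refine Finset.sum_congr rfl fun i _ => ?_
  rw [hφ, hφ, mul_mul_mul_comm, gue_identify p hdeg hlead ho]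
  ring

lemma gue_norm_exp (r u s : ℝ) :
    ‖cexp (((r : ℂ) + s * I - u) ^ 2)‖ = Real.exp ((r - u) ^ 2) * Real.exp (-1 * s ^ 2) := by
  rw [Complex.norm_exp, ← Real.exp_add]
  congr 1
  simp [pow_two]
  ring

lemma gue_integrable_cpoly (r u : ℝ) (Q : Polynomial ℂ) :
    Integrable (fun s : ℝ => Q.eval (s : ℂ) * cexp (((r : ℂ) + s * I - u) ^ 2)) := by
  induction Q using Polynomial.induction_on' with
  | add p q hp hq =>
    have h := hp.add hq
    refine h.congr (Eventually.of_forall fun t => ?_)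
    simp [add_mul]
  | monomial n a =>
    have h := ((gue_integrable_pow n 1 one_pos).norm).const_mul (‖a‖ * Real.exp ((r - u) ^ 2))
    refine h.mono' (by fun_prop) (Eventually.of_forall fun s => ?_)
    rw [norm_mul, gue_norm_exp, Polynomial.eval_monomial, norm_mul, norm_mul, norm_pow, norm_pow,
      Complex.norm_real, Real.norm_of_nonneg (Real.exp_nonneg (-1 * s ^ 2))]
    apply le_of_eq
    ring

lemma gue_integrable_w (r u : ℝ) (n : ℕ) :
    Integrable (fun s : ℝ => ((r : ℂ) + s * I) ^ n * cexp (((r : ℂ) + s * I - u) ^ 2)) := by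
  have := gue_integrable_cpoly r u ((Polynomial.C (r : ℂ) + Polynomial.X * Polynomial.C I) ^ n)
  simpa [mul_comm I] using this

/-- Contour integral. -/
def gueJ (r u : ℝ) (n : ℕ) : ℂ :=
  ∫ s : ℝ, ((r : ℂ) + s * I) ^ n * cexp (((r : ℂ) + s * I - u) ^ 2)

lemma gueJ_zero (r u : ℝ) : gueJ r u 0 = Real.sqrt Real.pi := by
  have h := GaussianFourier.integral_cexp_neg_mul_sq_add_real_mul_I (b := 1) (by simp) (-(r - u))
  have e : ((Real.pi : ℂ) / 1) ^ (1 / 2 : ℂ) = (Real.sqrt Real.pi : ℂ) := by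
    rw [div_one, Real.sqrt_eq_rpow, Complex.ofReal_cpow Real.pi_pos.le]
    norm_num
  rw [e] at h
  rw [← h, gueJ]
  congr 1
  ext s
  rw [pow_zero, one_mul]
  congr 1
  push_cast
  linear_combination (((s : ℂ) ^ 2 + (r - u) ^ 2)) * I_sq

lemma gueJ_succ (r u : ℝ) (n : ℕ) :
    gueJ r u (n + 1) = u * gueJ r u n - n / 2 * gueJ r u (n - 1) := by
  have h : gueJ r u (n + 1) - (u * gueJ r u n - n / 2 * gueJ r u (n - 1)) = 0 := by
    have i0 := gue_integrable_w r u (n + 1)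
    have i1 := (gue_integrable_w r u n).const_mul (u : ℂ)
    have i2 := (gue_integrable_w r u (n - 1)).const_mul ((n : ℂ) / 2)
    have i3 := (gue_integrable_w r u n).const_mul (1 / (2 * I))
    have i12 := i1.sub i2
    rw [Pi.sub_def] at i12
    have i012 := i0.sub i12
    rw [Pi.sub_def] at i012
    unfold gueJ
    rw [← integral_const_mul, ← integral_const_mul, ← integral_sub i1 i2, ← integral_sub i0 i12]
    apply integral_eq_zero_of_hasDerivAt_of_integrable _ i012 i3
    intro s
    have hw : HasDerivAt (fun s : ℝ => (r : ℂ) + s * I) I s := by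
      have := ((hasDerivAt_id (s : ℂ)).mul_const I).const_add (r : ℂ)
      simpa using this.comp_ofReal
    have h1 := hw.pow n
    have h2 := ((hw.sub_const (u : ℂ)).pow 2).cexp
    have h3 := (h1.mul h2).const_mul (1 / (2 * I))
    refine h3.congr_deriv ?_
    simp only [Pi.pow_apply, Nat.cast_ofNat, Nat.add_one_sub_one, pow_one]
    field_simp
    ring
  exact sub_eq_zero.1 h

lemma gueJ_eq (r u : ℝ) (n : ℕ) :
    gueJ r u n = Real.sqrt Real.pi * ((gueH n).eval u : ℝ) / 2 ^ n := by
  induction n using Nat.strong_induction_on with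
  | _ n ih =>
    match n with
    | 0 => simp [gueJ_zero, gueH]
    | 1 =>
      rw [gueJ_succ, gueJ_zero]
      simp [gueH]
      ring
    | n + 2 =>
      rw [gueJ_succ, ih (n + 1) (by omega), ih _ (by omega), gueH_succ (n + 1), gueH_deriv]
      simp only [Polynomial.eval_sub, Polynomial.eval_mul, Polynomial.eval_C, Polynomial.eval_X,
        Nat.add_one_sub_one]
      push_cast
      field_simp
      ring

/-- The vertical line. -/
def gueZ (τ : ℝ) : ℂ := 1 + τ * I

lemma gueZ_cont : Continuous gueZ := by unfold gueZ; fun_prop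

lemma gueZ_pow_le (τ : ℝ) (k : ℕ) (hk : k ≤ 1) : ‖(-gueZ τ) ^ k‖ ≤ 1 + |τ| := by
  have h0 := abs_nonneg τ
  interval_cases k
  · simp
  · rw [pow_one, norm_neg, gueZ]
    refine (norm_add_le _ _).trans ?_
    simp

lemma gue_bound_integrable (c : ℝ) :
    Integrable (fun τ : ℝ => (1 + |τ|) * (c * Real.exp (-(1 / 4) * τ ^ 2))) := by
  have h1 := (integrable_exp_neg_mul_sq (b := 1 / 4) (by norm_num)).const_mul c
  have h2 := ((integrable_mul_exp_neg_mul_sq (b := 1 / 4) (by norm_num)).norm).const_mul c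
  refine (h1.add h2).congr (Eventually.of_forall fun t => ?_)
  simp only [Pi.add_apply, norm_mul, Real.norm_eq_abs, abs_of_pos (Real.exp_pos _)]
  ring

/-- Airy integrand. -/
def gueAf (k : ℕ) (x τ : ℝ) : ℂ := (-gueZ τ) ^ k * cexp (gueZ τ ^ 3 / 3 - x * gueZ τ)

/-- Airy integral. -/
def gueA (k : ℕ) (x : ℝ) : ℂ := ∫ τ : ℝ, gueAf k x τ

/-- Hermite integrand. -/
def gueGf (N : ℕ) (ε : ℝ) (k : ℕ) (x τ : ℝ) : ℂ :=
  (-gueZ τ) ^ k * ((1 + ε * gueZ τ) ^ N *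
    cexp (-(N * ε * gueZ τ) + N / 2 * ε ^ 2 * gueZ τ ^ 2 - x * gueZ τ))

/-- Hermite integral. -/
def gueG (N : ℕ) (ε : ℝ) (k : ℕ) (x : ℝ) : ℂ := ∫ τ : ℝ, gueGf N ε k x τ

lemma gue_norm_le (N : ℕ) (ε : ℝ) (h0 : 0 ≤ ε) (h1 : ε ≤ 1) (hN : N * ε ^ 3 = 1) (x τ : ℝ) :
    ‖(1 + ε * gueZ τ) ^ N *
      cexp (-(N * ε * gueZ τ) + N / 2 * ε ^ 2 * gueZ τ ^ 2 - x * gueZ τ)‖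
    ≤ Real.exp (1 / 2 - x) * Real.exp (-(1 / 4) * τ ^ 2) := by
  have ht : 1 + ε ≤ Real.exp (ε - ε ^ 2 / 2 + ε ^ 3 / 2) := by
    have h2 : 0 ≤ ε - ε ^ 2 / 2 + ε ^ 3 / 2 := by
      have : 0 ≤ ε * (1 - ε / 2 + ε ^ 2 / 2) := mul_nonneg h0 (by nlinarith)
      nlinarith
    refine le_trans ?_ (Real.quadratic_le_exp_of_nonneg h2)
    have : 0 ≤ ε ^ 4 * (5 / 8 - ε / 4 + ε ^ 2 / 8) := mul_nonneg (by positivity) (by nlinarith)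
    nlinarith
  have hq : ‖1 + ε * gueZ τ‖ ≤
      Real.exp (ε - ε ^ 2 / 2 + ε ^ 3 / 2 + ε ^ 2 * τ ^ 2 * (1 - ε / 2) / 2) := by
    apply le_of_sq_le_sq _ (Real.exp_nonneg _)
    rw [← Complex.normSq_eq_norm_sq, Complex.normSq_apply]
    have e1 : (1 + ε * gueZ τ).re = 1 + ε := by simp [gueZ]
    have e2 : (1 + ε * gueZ τ).im = ε * τ := by simp [gueZ]
    rw [e1, e2]
    have e3 : Real.exp (ε - ε ^ 2 / 2 + ε ^ 3 / 2 + ε ^ 2 * τ ^ 2 * (1 - ε / 2) / 2) ^ 2 =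
      Real.exp (ε - ε ^ 2 / 2 + ε ^ 3 / 2) ^ 2 * Real.exp (ε ^ 2 * τ ^ 2 * (1 - ε / 2)) := by
      rw [← Real.exp_nat_mul, ← Real.exp_nat_mul, ← Real.exp_add]
      congr 1
      push_cast
      ring
    rw [e3]
    have h3 : 1 + ε ^ 2 * τ ^ 2 * (1 - ε / 2) ≤ Real.exp (ε ^ 2 * τ ^ 2 * (1 - ε / 2)) := by
      rw [add_comm]; exact Real.add_one_le_exp _
    have h4 : (1 + ε) ^ 2 ≤ Real.exp (ε - ε ^ 2 / 2 + ε ^ 3 / 2) ^ 2 := by gcongr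
    have h5 : 0 ≤ ε ^ 2 * τ ^ 2 * (1 - ε / 2) := mul_nonneg (by positivity) (by linarith)
    refine le_trans ?_ (mul_le_mul h4 h3 (by linarith) (by positivity))
    have h6 : 1 ≤ (1 + ε) ^ 2 * (1 - ε / 2) := by
      have : 0 ≤ ε * (3 / 2 - ε ^ 2 / 2) := mul_nonneg h0 (by nlinarith)
      nlinarith
    have h7 := mul_le_mul_of_nonneg_left h6 (by positivity : 0 ≤ ε ^ 2 * τ ^ 2)
    nlinarith
  rw [norm_mul, norm_pow, Complex.norm_exp]
  have e4 : (-(N * ε * gueZ τ) + N / 2 * ε ^ 2 * gueZ τ ^ 2 - x * gueZ τ : ℂ).re =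
      -(N * ε) + N / 2 * ε ^ 2 * (1 - τ ^ 2) - x := by
    have : (-(N * ε * gueZ τ) + N / 2 * ε ^ 2 * gueZ τ ^ 2 - x * gueZ τ : ℂ) =
      ((-(N * ε) + N / 2 * ε ^ 2 * (1 - τ ^ 2) - x : ℝ) : ℂ) +
      ((-(N * ε * τ) + N * ε ^ 2 * τ - x * τ : ℝ) : ℂ) * I := by
      unfold gueZ
      push_cast
      linear_combination (N / 2 * ε ^ 2 * τ ^ 2 : ℂ) * I_sq
    rw [this, Complex.add_re, Complex.ofReal_re, Complex.re_ofReal_mul, Complex.I_re]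
    ring
  rw [e4]
  refine (mul_le_mul_of_nonneg_right (pow_le_pow_left₀ (norm_nonneg _) hq N)
    (Real.exp_nonneg _)).trans ?_
  rw [← Real.exp_nat_mul, ← Real.exp_add, ← Real.exp_add]
  apply le_of_eq
  congr 1
  linear_combination (1 / 2 - τ ^ 2 / 4) * hN

lemma gueGf_norm_le (N : ℕ) (ε : ℝ) (h0 : 0 ≤ ε) (h1 : ε ≤ 1) (hN : N * ε ^ 3 = 1) (k : ℕ)
    (hk : k ≤ 1) (x τ : ℝ) :
    ‖gueGf N ε k x τ‖ ≤ (1 + |τ|) * (Real.exp (1 / 2 - x) * Real.exp (-(1 / 4) * τ ^ 2)) := by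
  rw [gueGf, norm_mul]
  exact mul_le_mul (gueZ_pow_le τ k hk) (gue_norm_le N ε h0 h1 hN x τ) (norm_nonneg _)
    (by positivity)

lemma gueGf_cont (N : ℕ) (ε : ℝ) (k : ℕ) (x : ℝ) : Continuous (gueGf N ε k x) := by
  have := gueZ_cont
  unfold gueGf
  fun_prop

lemma gueAf_cont (k : ℕ) (x : ℝ) : Continuous (gueAf k x) := by
  have := gueZ_cont
  unfold gueAf
  fun_prop

lemma gueGf_integrable (N : ℕ) (ε : ℝ) (h0 : 0 ≤ ε) (h1 : ε ≤ 1) (hN : N * ε ^ 3 = 1) (k : ℕ)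
    (hk : k ≤ 1) (x : ℝ) : Integrable (gueGf N ε k x) :=
  (gue_bound_integrable _).mono' (gueGf_cont N ε k x).aestronglyMeasurable
    (Eventually.of_forall fun τ => gueGf_norm_le N ε h0 h1 hN k hk x τ)

lemma gue_log_bound (y : ℂ) (hy : ‖y‖ ≤ 1 / 2) :
    ‖Complex.log (1 + y) - (y - y ^ 2 / 2 + y ^ 3 / 3)‖ ≤ ‖y‖ ^ 4 := by
  have h := Complex.norm_log_sub_logTaylor_le 3 (z := y) (by linarith)
  have e : Complex.logTaylor (3 + 1) y = y - y ^ 2 / 2 + y ^ 3 / 3 := by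
    simp [Complex.logTaylor, Finset.sum_range_succ]
    ring
  rw [e] at h
  refine h.trans ?_
  have h2 : (1 - ‖y‖)⁻¹ ≤ 2 := by
    rw [inv_le_comm₀ (by linarith) (by norm_num)]
    linarith
  have h3 : 0 ≤ ‖y‖ ^ 4 := by positivity
  push_cast
  norm_num
  nlinarith [mul_le_mul_of_nonneg_left h2 h3]

lemma gueGf_tendsto (ε : ℕ → ℝ) (h0 : ∀ᶠ n in atTop, 0 < ε n)
    (hN : ∀ᶠ n : ℕ in atTop, n * ε n ^ 3 = 1) (hε : Tendsto ε atTop (nhds 0)) (k : ℕ) (x τ : ℝ) :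
    Tendsto (fun n : ℕ => gueGf n (ε n) k x τ) atTop (nhds (gueAf k x τ)) := by
  set z := gueZ τ with hz
  have hsmall : ∀ᶠ n in atTop, ‖(ε n : ℂ) * z‖ ≤ 1 / 2 := by
    have : Tendsto (fun n => ‖(ε n : ℂ) * z‖) atTop (nhds 0) := by
      have h := hε.norm.mul_const ‖z‖
      simpa using h
    exact this.eventually (Iic_mem_nhds (by norm_num))
  have hlog : Tendsto (fun n : ℕ => (n : ℂ) * (Complex.log (1 + ε n * z) -
      (ε n * z - (ε n * z) ^ 2 / 2 + (ε n * z) ^ 3 / 3))) atTop (nhds 0) := by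
    apply squeeze_zero_norm' (a := fun n => ε n * ‖z‖ ^ 4)
    · filter_upwards [hsmall, hN, h0] with n h1 h2 h3
      rw [norm_mul, Complex.norm_natCast]
      refine (mul_le_mul_of_nonneg_left (gue_log_bound _ h1) (by positivity)).trans (le_of_eq ?_)
      rw [norm_mul, Complex.norm_real, Real.norm_of_nonneg h3.le]
      linear_combination ε n * ‖z‖ ^ 4 * h2
    · simpa using hε.mul_const (‖z‖ ^ 4)
  have hE := ((hlog.add_const (z ^ 3 / 3 - x * z)).cexp).const_mul ((-z) ^ k)
  rw [zero_add] at hE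
  unfold gueAf
  refine hE.congr' ?_
  filter_upwards [hsmall, hN] with n h1 h2
  rw [gueGf, ← hz]
  have hne : 1 + (ε n : ℂ) * z ≠ 0 := by
    intro h
    have : (ε n : ℂ) * z = -1 := by linear_combination h
    rw [this] at h1
    norm_num at h1
  congr 1
  have h2' : (n : ℂ) * (ε n : ℂ) ^ 3 = 1 := by exact_mod_cast h2
  nth_rewrite 2 [← Complex.exp_log hne]
  rw [← Complex.exp_nat_mul, ← Complex.exp_add]
  congr 1
  linear_combination (- z ^ 3 / 3) * h2'

lemma gueG_tendsto (ε : ℕ → ℝ) (h0 : ∀ᶠ n in atTop, 0 < ε n)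
    (hN : ∀ᶠ n : ℕ in atTop, n * ε n ^ 3 = 1) (hε : Tendsto ε atTop (nhds 0)) (k : ℕ)
    (hk : k ≤ 1) (x : ℝ) :
    Tendsto (fun n : ℕ => gueG n (ε n) k x) atTop (nhds (gueA k x)) := by
  unfold gueG gueA
  refine tendsto_integral_filter_of_dominated_convergence _
    (Eventually.of_forall fun n => (gueGf_cont n (ε n) k x).aestronglyMeasurable) ?_
    (gue_bound_integrable (Real.exp (1 / 2 - x)))
    (Eventually.of_forall fun τ => gueGf_tendsto ε h0 hN hε k x τ)
  filter_upwards [h0, hN, hε.eventually (Iic_mem_nhds one_pos)] with n a b c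
  exact Eventually.of_forall fun τ => gueGf_norm_le n _ a.le c b k hk x τ

lemma gueAf_norm (k : ℕ) (x τ : ℝ) :
    ‖gueAf k x τ‖ = ‖(-gueZ τ) ^ k‖ * Real.exp (1 / 3 - x - τ ^ 2) := by
  rw [gueAf, norm_mul, Complex.norm_exp]
  congr 2
  have : (gueZ τ ^ 3 / 3 - x * gueZ τ : ℂ) =
      ((1 / 3 - x - τ ^ 2 : ℝ) : ℂ) + ((τ - τ ^ 3 / 3 - x * τ : ℝ) : ℂ) * I := by
    unfold gueZ
    push_cast
    linear_combination (τ ^ 2 + τ ^ 3 / 3 * I : ℂ) * I_sq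
  rw [this, Complex.add_re, Complex.ofReal_re, Complex.re_ofReal_mul, Complex.I_re]
  ring

lemma gueAf_norm_le (k : ℕ) (hk : k ≤ 1) (x c τ : ℝ) (hc : -c ≤ x) :
    ‖gueAf k x τ‖ ≤ (1 + |τ|) * (Real.exp (1 / 3 + c) * Real.exp (-(1 / 4) * τ ^ 2)) := by
  rw [gueAf_norm, ← Real.exp_add]
  refine mul_le_mul (gueZ_pow_le τ k hk) (Real.exp_le_exp.2 ?_) (Real.exp_nonneg _) (by positivity)
  nlinarith [sq_nonneg τ]

lemma gueAf_integrable (k : ℕ) (hk : k ≤ 1) (x : ℝ) : Integrable (gueAf k x) :=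
  (gue_bound_integrable _).mono' (gueAf_cont k x).aestronglyMeasurable
    (Eventually.of_forall fun τ => gueAf_norm_le k hk x (-x) τ (by simp))

lemma gueA_hasDerivAt (x : ℝ) : HasDerivAt (gueA 0) (gueA 1 x) x := by
  have hs : Ioo (x - 1) (x + 1) ∈ nhds x := Ioo_mem_nhds (by linarith) (by linarith)
  refine (hasDerivAt_integral_of_dominated_loc_of_deriv_le (F := gueAf 0) (F' := gueAf 1)
    (bound := fun τ => (1 + |τ|) * (Real.exp (1 / 3 + (1 - x)) * Real.exp (-(1 / 4) * τ ^ 2))) hs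
    (Eventually.of_forall fun y => (gueAf_cont 0 y).aestronglyMeasurable)
    (gueAf_integrable 0 (by norm_num) x) (gueAf_cont 1 x).aestronglyMeasurable ?_
    (gue_bound_integrable _) ?_).2
  · refine Eventually.of_forall fun τ y hy => gueAf_norm_le 1 le_rfl y _ τ ?_
    have := hy.1
    linarith
  · refine Eventually.of_forall fun τ y _ => ?_
    unfold gueAf
    have h1 : HasDerivAt (fun y : ℝ => gueZ τ ^ 3 / 3 - (y : ℂ) * gueZ τ) (-gueZ τ) y := by
      have := ((hasDerivAt_id (y : ℂ)).mul_const (gueZ τ)).const_sub (gueZ τ ^ 3 / 3)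
      simpa using this.comp_ofReal
    have h2 := h1.cexp
    simp only [pow_zero, one_mul, pow_one]
    rw [mul_comm]
    exact h2

/-- Entire Airy integrand. -/
def gueF (x : ℝ) (ζ : ℂ) : ℂ := cexp (I * (ζ ^ 3 / 3 + ζ * x))

lemma gueF_diff (x : ℝ) : Differentiable ℂ (gueF x) := by unfold gueF; fun_prop

lemma gueF_norm_le (x B y : ℝ) (hy : y ∈ Icc (0 : ℝ) 1) :
    ‖gueF x (B + y * I)‖ ≤ Real.exp (1 / 3 + |x| - B ^ 2 * y) := by
  rw [gueF, Complex.norm_exp]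
  apply Real.exp_le_exp.2
  have : (I * (((B : ℂ) + y * I) ^ 3 / 3 + (B + y * I) * x) : ℂ) =
      ((y ^ 3 / 3 - B ^ 2 * y - x * y : ℝ) : ℂ) + ((B ^ 3 / 3 - B * y ^ 2 + B * x : ℝ) : ℂ) * I := by
    push_cast
    linear_combination (B ^ 2 * y + x * y + B * y ^ 2 * I + y ^ 3 / 3 * (I ^ 2 - 1) : ℂ) * I_sq
  rw [this, Complex.add_re, Complex.ofReal_re, Complex.re_ofReal_mul, Complex.I_re]
  obtain ⟨h0, h1⟩ := hy
  have h2 : y ^ 3 ≤ 1 := pow_le_one₀ h0 h1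
  have h3 : -(x * y) ≤ |x| := by
    refine (neg_le_abs _).trans ?_
    rw [abs_mul, abs_of_nonneg h0]
    nlinarith [abs_nonneg x]
  linarith

lemma gueF_vert (x : ℝ) (g : ℝ → ℝ) (hg : ∀ B, g B ^ 2 = B ^ 2) :
    Tendsto (fun B : ℝ => ∫ y in (0 : ℝ)..1, gueF x (g B + y * I)) atTop (nhds 0) := by
  have h := intervalIntegral.tendsto_integral_filter_of_dominated_convergence
    (μ := volume) (a := 0) (b := 1) (l := atTop)
    (F := fun (B : ℝ) (y : ℝ) => gueF x (g B + y * I)) (f := fun _ => 0)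
    (fun _ => Real.exp (1 / 3 + |x|)) ?_ ?_ ?_ ?_
  · simpa using h
  · refine Eventually.of_forall fun B => ?_
    have hc := (gueF_diff x).continuous
    have : Continuous (fun y : ℝ => gueF x (g B + y * I)) := by fun_prop
    exact this.aestronglyMeasurable
  · refine Eventually.of_forall fun B => Eventually.of_forall fun y hy => ?_
    rw [uIoc_of_le zero_le_one] at hy
    refine (gueF_norm_le x (g B) y ⟨hy.1.le, hy.2⟩).trans (Real.exp_le_exp.2 ?_)
    have := mul_nonneg (sq_nonneg (g B)) hy.1.le
    linarith
  · exact intervalIntegrable_const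
  · refine Eventually.of_forall fun y hy => ?_
    rw [uIoc_of_le zero_le_one] at hy
    apply squeeze_zero_norm (fun B => gueF_norm_le x (g B) y ⟨hy.1.le, hy.2⟩)
    apply Real.tendsto_exp_atBot.comp
    simp only [hg]
    apply tendsto_atBot_add_const_left _ (1 / 3 + |x|) (f := fun B : ℝ => -(B ^ 2 * y)) _ |>.congr
    · intro B; ring
    · exact tendsto_neg_atTop_atBot.comp
        ((tendsto_pow_atTop (two_ne_zero)).atTop_mul_const hy.1)

lemma gueF_shift (x τ : ℝ) : gueF x (τ + I) = gueAf 0 x (-τ) := by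
  rw [gueF, gueAf, pow_zero, one_mul, gueZ]
  congr 1
  push_cast
  linear_combination (I * (τ : ℂ) + I * (τ : ℂ) ^ 3 / 3 + x + (I ^ 2 - 1) / 3) * I_sq

lemma gue_airy (Ai : ℝ → ℝ)
    (hAi : ∀ x : ℝ, Tendsto
      (fun B : ℝ => (1 / (2 * Real.pi) : ℂ) *
        ∫ t in (-B)..B, Complex.exp (Complex.I * ((t : ℂ) ^ 3 / 3 + (t : ℂ) * (x : ℂ))))
      atTop (nhds ((Ai x : ℝ) : ℂ))) (x : ℝ) : ((Ai x : ℝ) : ℂ) = 1 / (2 * Real.pi) * gueA 0 x := by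
  refine tendsto_nhds_unique (hAi x) (Tendsto.const_mul _ ?_)
  have h1 : ∀ B : ℝ, ∫ t in (-B)..B, cexp (I * ((t : ℂ) ^ 3 / 3 + (t : ℂ) * (x : ℂ))) =
      (∫ t in (-B)..B, gueAf 0 x (-t)) - I * (∫ y in (0 : ℝ)..1, gueF x (B + y * I))
        + I * (∫ y in (0 : ℝ)..1, gueF x ((-B : ℝ) + y * I)) := by
    intro B
    have h := Complex.integral_boundary_rect_eq_zero_of_differentiableOn (gueF x)
      ((-B : ℝ) : ℂ) (B + I) (gueF_diff x).differentiableOn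
    simp only [Complex.ofReal_re, Complex.ofReal_im, Complex.add_re, Complex.add_im, Complex.I_re,
      Complex.I_im, add_zero, zero_add, Complex.ofReal_zero, zero_mul, Complex.ofReal_one, one_mul,
      smul_eq_mul, gueF_shift] at h
    have e : ∫ t in (-B)..B, cexp (I * ((t : ℂ) ^ 3 / 3 + (t : ℂ) * (x : ℂ))) =
      ∫ t in (-B)..B, gueF x t := rfl
    rw [e]
    linear_combination h
  simp only [h1]
  have i := (gueAf_integrable 0 (by norm_num) x).comp_neg
  have t1 := intervalIntegral_tendsto_integral i tendsto_neg_atTop_atBot tendsto_id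
  rw [integral_neg_eq_self (gueAf 0 x)] at t1
  have t2 := (gueF_vert x id (fun _ => rfl)).const_mul I
  have t3 := (gueF_vert x (fun B => -B) (fun B => by ring)).const_mul I
  have t := (t1.sub t2).add t3
  simpa [gueA] using t

lemma gue_airy_deriv (Ai : ℝ → ℝ) (hA : ∀ x, ((Ai x : ℝ) : ℂ) = 1 / (2 * Real.pi) * gueA 0 x)
    (hd : Differentiable ℝ Ai) (x : ℝ) :
    ((deriv Ai x : ℝ) : ℂ) = 1 / (2 * Real.pi) * gueA 1 x := by
  have h1 : HasDerivAt (fun x => ((Ai x : ℝ) : ℂ)) ((deriv Ai x : ℝ) : ℂ) x :=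
    (hd x).hasDerivAt.ofReal_comp
  have h2 := (gueA_hasDerivAt x).const_mul (1 / (2 * Real.pi) : ℂ)
  rw [funext hA] at h1
  exact h1.unique h2

/-- Amplitude. -/
def gueP (N : ℕ) (ν : ℝ) : ℝ :=
  2 ^ N / Real.sqrt Real.pi * (ν / Real.sqrt 2) * (ν ^ 3 / Real.sqrt 2) ^ N *
    Real.exp (-(ν ^ 6 / 2))

lemma gue_point (N : ℕ) (ν : ℝ) (hν : 0 < ν) (hN : ν ^ 6 = N) (x τ : ℝ) :
    (((ν ^ 3 / Real.sqrt 2 + ν / Real.sqrt 2 : ℝ) : ℂ) + (ν / Real.sqrt 2 * τ : ℝ) * I) ^ N *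
      cexp ((((ν ^ 3 / Real.sqrt 2 + ν / Real.sqrt 2 : ℝ) : ℂ) + (ν / Real.sqrt 2 * τ : ℝ) * I -
        (x / (Real.sqrt 2 * ν) + Real.sqrt 2 * ν ^ 3 : ℝ)) ^ 2) =
    ((ν ^ 3 / Real.sqrt 2) ^ N * Real.exp (-(ν ^ 6 / 2)) *
      Real.exp ((x / (Real.sqrt 2 * ν)) ^ 2 / 2) *
      Real.exp ((x / (Real.sqrt 2 * ν) + Real.sqrt 2 * ν ^ 3) ^ 2 / 2) : ℝ) *
      gueGf N ((ν ^ 2)⁻¹) 0 x τ := by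
  have h2 : (Real.sqrt 2 : ℂ) ^ 2 = 2 := by
    rw [← Complex.ofReal_pow, Real.sq_sqrt (by norm_num)]; simp
  have hs : (Real.sqrt 2 : ℂ) ≠ 0 := by
    intro h; rw [h] at h2; norm_num at h2
  have hν' : (ν : ℂ) ≠ 0 := by exact_mod_cast hν.ne'
  have hN' : (N : ℂ) = (ν : ℂ) ^ 6 := by exact_mod_cast hN.symm
  have e1 : ((ν ^ 3 / Real.sqrt 2 + ν / Real.sqrt 2 : ℝ) : ℂ) + (ν / Real.sqrt 2 * τ : ℝ) * I =
      (ν ^ 3 / Real.sqrt 2 : ℝ) * (1 + ((ν ^ 2)⁻¹ : ℝ) * gueZ τ) := by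
    unfold gueZ
    push_cast
    field_simp
    ring
  rw [e1, gueGf, mul_pow, pow_zero, one_mul]
  push_cast
  have key : cexp ((((ν : ℂ) ^ 3 / Real.sqrt 2) * (1 + ((ν : ℂ) ^ 2)⁻¹ * gueZ τ) -
        (x / (Real.sqrt 2 * ν) + Real.sqrt 2 * ν ^ 3)) ^ 2) =
      cexp (-((ν : ℂ) ^ 6 / 2)) * cexp (((x : ℂ) / (Real.sqrt 2 * ν)) ^ 2 / 2) *
      cexp (((x : ℂ) / (Real.sqrt 2 * ν) + Real.sqrt 2 * ν ^ 3) ^ 2 / 2) *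
      cexp (-(N * ((ν : ℂ) ^ 2)⁻¹ * gueZ τ) + N / 2 * ((ν : ℂ) ^ 2)⁻¹ ^ 2 * gueZ τ ^ 2
        - x * gueZ τ) := by
    rw [← Complex.exp_add, ← Complex.exp_add, ← Complex.exp_add]
    congr 1
    rw [hN']
    generalize gueZ τ = z
    have hq : (Real.sqrt 2 : ℂ)⁻¹ = Real.sqrt 2 / 2 := by
      field_simp
      exact h2.symm
    simp only [div_eq_mul_inv, mul_inv, hq]
    generalize (Real.sqrt 2 : ℂ) = q at *
    field_simp
    ring_nf
    simp only [h2]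
    ring
  rw [key]
  ring

/-- Constant in the pointwise identity. -/
def gueC (N : ℕ) (ν x : ℝ) : ℝ := (ν ^ 3 / Real.sqrt 2) ^ N * Real.exp (-(ν ^ 6 / 2)) *
      Real.exp ((x / (Real.sqrt 2 * ν)) ^ 2 / 2) *
      Real.exp ((x / (Real.sqrt 2 * ν) + Real.sqrt 2 * ν ^ 3) ^ 2 / 2)

lemma gueJ_scale (b r u : ℝ) (hb : 0 < b) (n : ℕ) :
    gueJ r u n = b * ∫ τ : ℝ, ((r : ℂ) + (b * τ : ℝ) * I) ^ n *
      cexp (((r : ℂ) + (b * τ : ℝ) * I - u) ^ 2) := by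
  have h := Measure.integral_comp_mul_left (fun s : ℝ => ((r : ℂ) + s * I) ^ n *
      cexp (((r : ℂ) + s * I - u) ^ 2)) b
  rw [h, gueJ, abs_of_pos (inv_pos.2 hb), Complex.real_smul, ← mul_assoc, ← Complex.ofReal_mul,
    mul_inv_cancel₀ hb.ne']
  simp

lemma gueJ_rep0 (N : ℕ) (ν : ℝ) (hν : 0 < ν) (hN : ν ^ 6 = N) (x : ℝ) :
    gueJ (ν ^ 3 / Real.sqrt 2 + ν / Real.sqrt 2) (x / (Real.sqrt 2 * ν) + Real.sqrt 2 * ν ^ 3) N =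
    (ν / Real.sqrt 2 : ℝ) * ((gueC N ν x : ℝ) * gueG N ((ν ^ 2)⁻¹) 0 x) := by
  rw [gueJ_scale (ν / Real.sqrt 2) _ _ (by positivity)]
  congr 1
  rw [gueG, ← integral_const_mul]
  simp only [gue_point N ν hν hN x]
  rfl

lemma gueJ_rep1 (N : ℕ) (ν : ℝ) (h1 : 1 ≤ ν) (hN : ν ^ 6 = N) (x : ℝ) :
    gueJ (ν ^ 3 / Real.sqrt 2 + ν / Real.sqrt 2) (x / (Real.sqrt 2 * ν) + Real.sqrt 2 * ν ^ 3)
      (N + 1) =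
    (ν / Real.sqrt 2 : ℝ) * ((gueC N ν x : ℝ) *
      ((ν ^ 3 / Real.sqrt 2 : ℝ) * gueG N ((ν ^ 2)⁻¹) 0 x -
        (ν / Real.sqrt 2 : ℝ) * gueG N ((ν ^ 2)⁻¹) 1 x)) := by
  have hν : 0 < ν := by linarith
  have a0 : 0 ≤ (ν ^ 2)⁻¹ := by positivity
  have a1 : (ν ^ 2)⁻¹ ≤ 1 := inv_le_one_of_one_le₀ (one_le_pow₀ h1)
  have a2 : N * (ν ^ 2)⁻¹ ^ 3 = 1 := by rw [← hN]; field_simp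
  have i0 := (gueGf_integrable N _ a0 a1 a2 0 (by norm_num) x).const_mul
    ((ν ^ 3 / Real.sqrt 2 : ℝ) : ℂ)
  have i1 := (gueGf_integrable N _ a0 a1 a2 1 (by norm_num) x).const_mul
    ((ν / Real.sqrt 2 : ℝ) : ℂ)
  rw [gueJ_scale (ν / Real.sqrt 2) _ _ (by positivity)]
  congr 1
  rw [gueG, gueG, ← integral_const_mul,
    ← integral_const_mul, ← integral_sub i0 i1, ← integral_const_mul]
  congr 1
  ext τ
  rw [pow_succ', mul_assoc, gue_point N ν hν hN x, gueC]
  have e : gueGf N ((ν ^ 2)⁻¹) 1 x τ = -gueZ τ * gueGf N ((ν ^ 2)⁻¹) 0 x τ := by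
    simp [gueGf]
  rw [e]
  generalize gueGf N ((ν ^ 2)⁻¹) 0 x τ = g
  unfold gueZ
  push_cast
  ring

lemma gueH_of_J (r u : ℝ) (n : ℕ) :
    (((gueH n).eval u : ℝ) : ℂ) = 2 ^ n / Real.sqrt Real.pi * gueJ r u n := by
  have hs : ((Real.sqrt Real.pi : ℝ) : ℂ) ≠ 0 := by
    have : Real.sqrt Real.pi ≠ 0 := by positivity
    exact_mod_cast this
  rw [gueJ_eq]
  field_simp

lemma gueC_eq (N : ℕ) (ν x : ℝ) :
    2 ^ N / Real.sqrt Real.pi * (ν / Real.sqrt 2) * gueC N ν x *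
      Real.exp (-(x / (Real.sqrt 2 * ν) + Real.sqrt 2 * ν ^ 3) ^ 2 / 2) =
    gueP N ν * Real.exp ((x / (Real.sqrt 2 * ν)) ^ 2 / 2) := by
  rw [neg_div, Real.exp_neg, gueC, gueP]
  have := (Real.exp_pos ((x / (Real.sqrt 2 * ν) + Real.sqrt 2 * ν ^ 3) ^ 2 / 2)).ne'
  generalize Real.exp ((x / (Real.sqrt 2 * ν) + Real.sqrt 2 * ν ^ 3) ^ 2 / 2) = e at *
  generalize (ν ^ 3 / Real.sqrt 2) ^ N = f
  generalize Real.exp (-(ν ^ 6 / 2)) = f'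
  generalize Real.exp ((x / (Real.sqrt 2 * ν)) ^ 2 / 2) = f''
  field_simp

lemma gue_rep0 (N : ℕ) (ν : ℝ) (hν : 0 < ν) (hN : ν ^ 6 = N) (x : ℝ) :
    (((gueH N).eval (x / (Real.sqrt 2 * ν) + Real.sqrt 2 * ν ^ 3) *
      Real.exp (-(x / (Real.sqrt 2 * ν) + Real.sqrt 2 * ν ^ 3) ^ 2 / 2) : ℝ) : ℂ) =
    (gueP N ν * Real.exp ((x / (Real.sqrt 2 * ν)) ^ 2 / 2) : ℝ) * gueG N ((ν ^ 2)⁻¹) 0 x := by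
  rw [← gueC_eq, Complex.ofReal_mul, gueH_of_J (ν ^ 3 / Real.sqrt 2 + ν / Real.sqrt 2),
    gueJ_rep0 N ν hν hN]
  push_cast
  ring

lemma gue_rep1 (N : ℕ) (ν : ℝ) (h1 : 1 ≤ ν) (hN : ν ^ 6 = N) (x : ℝ) :
    (((Polynomial.derivative (gueH N)).eval (x / (Real.sqrt 2 * ν) + Real.sqrt 2 * ν ^ 3) *
      Real.exp (-(x / (Real.sqrt 2 * ν) + Real.sqrt 2 * ν ^ 3) ^ 2 / 2) : ℝ) : ℂ) =
    (gueP N ν * Real.exp ((x / (Real.sqrt 2 * ν)) ^ 2 / 2) : ℝ) *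
      ((2 * (x / (Real.sqrt 2 * ν) + Real.sqrt 2 * ν ^ 3) - 2 * (ν ^ 3 / Real.sqrt 2) : ℝ) *
        gueG N ((ν ^ 2)⁻¹) 0 x + (2 * (ν / Real.sqrt 2) : ℝ) * gueG N ((ν ^ 2)⁻¹) 1 x) := by
  have hd : ∀ u, (Polynomial.derivative (gueH N)).eval u =
      2 * u * (gueH N).eval u - (gueH (N + 1)).eval u := by
    intro u
    rw [gueH_succ]
    simp
  rw [hd, ← gueC_eq, Complex.ofReal_mul, Complex.ofReal_sub, Complex.ofReal_mul (2 * _),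
    gueH_of_J (ν ^ 3 / Real.sqrt 2 + ν / Real.sqrt 2) _ N,
    gueH_of_J (ν ^ 3 / Real.sqrt 2 + ν / Real.sqrt 2) _ (N + 1),
    gueJ_rep0 N ν (by linarith) hN, gueJ_rep1 N ν h1 hN]
  generalize gueG N ((ν ^ 2)⁻¹) 0 x = g0
  generalize gueG N ((ν ^ 2)⁻¹) 1 x = g1
  generalize x / (Real.sqrt 2 * ν) + Real.sqrt 2 * ν ^ 3 = u
  generalize ν ^ 3 / Real.sqrt 2 = a
  generalize ν / Real.sqrt 2 = b
  push_cast
  ring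

/-- Stirling-type constant. -/
def gueS (N : ℕ) (ν : ℝ) : ℝ :=
  gueP N ν ^ 2 * (2 * (ν / Real.sqrt 2)) / (2 ^ (N + 1) * (N.factorial : ℝ)) / Real.sqrt Real.pi

lemma gueS_eq (N : ℕ) (ν : ℝ) (hν : 0 < ν) (hN : ν ^ 6 = N) :
    gueS N ν = (Stirling.stirlingSeq N)⁻¹ * (4 * Real.pi * Real.sqrt Real.pi)⁻¹ := by
  have h2 : Real.sqrt 2 ^ 2 = 2 := Real.sq_sqrt (by norm_num)
  have hp : Real.sqrt Real.pi ^ 2 = Real.pi := Real.sq_sqrt Real.pi_pos.le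
  have e1 : Real.sqrt (2 * N) = Real.sqrt 2 * ν ^ 3 := by
    rw [Real.sqrt_mul (by norm_num), ← hN, show ν ^ 6 = (ν ^ 3) ^ 2 by ring,
      Real.sqrt_sq (by positivity)]
  have e2 : ((ν ^ 3 / Real.sqrt 2) ^ N) ^ 2 = N ^ N / 2 ^ N := by
    rw [← pow_mul, mul_comm, pow_mul, div_pow, h2, ← pow_mul, div_pow]
    norm_num [hN]
  have e3 : Real.exp (-(ν ^ 6 / 2)) ^ 2 = (Real.exp 1 ^ N)⁻¹ := by
    rw [← Real.exp_nat_mul, ← Real.exp_nat_mul, ← Real.exp_neg, hN]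
    congr 1
    push_cast
    ring
  have hNp : (0 : ℝ) < N := by rw [← hN]; positivity
  rw [gueS, gueP, Stirling.stirlingSeq, e1, mul_pow, mul_pow _ ((ν ^ 3 / Real.sqrt 2) ^ N), e2, e3]
  have q1 : Real.exp 1 ^ N ≠ 0 := by positivity
  have q2 : (N : ℝ) ^ N ≠ 0 := by positivity
  have q3 : (N.factorial : ℝ) ≠ 0 := by positivity
  rw [div_pow (N : ℝ)]
  generalize Real.exp 1 ^ N = E at *
  generalize (N : ℝ) ^ N = M at *
  have q4 : Real.sqrt Real.pi ≠ 0 := by positivity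
  have q5 : Real.sqrt 2 ≠ 0 := by positivity
  rw [← hp, Real.sqrt_sq (by positivity)]
  generalize Real.sqrt Real.pi = w at *
  generalize Real.sqrt 2 = q at *
  rw [pow_succ 2 N]
  field_simp
  have h4 : q ^ 4 = 4 := by
    rw [show (4 : ℕ) = 2 * 2 from rfl, pow_mul, h2]; norm_num
  try rw [h4]
  try ring

lemma gueS_tendsto (ν : ℕ → ℝ) (h0 : ∀ᶠ n in atTop, 0 < ν n)
    (hN : ∀ᶠ n : ℕ in atTop, ν n ^ 6 = n) :
    Tendsto (fun n : ℕ => gueS n (ν n)) atTop (nhds (1 / (2 * Real.pi) * (1 / (2 * Real.pi)))) := by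
  have hs : Real.sqrt Real.pi ≠ 0 := by positivity
  have h := (Stirling.tendsto_stirlingSeq_sqrt_pi.inv₀ hs).mul_const
    (4 * Real.pi * Real.sqrt Real.pi)⁻¹
  have e : (Real.sqrt Real.pi)⁻¹ * (4 * Real.pi * Real.sqrt Real.pi)⁻¹ =
      1 / (2 * Real.pi) * (1 / (2 * Real.pi)) := by
    have hp : Real.sqrt Real.pi ^ 2 = Real.pi := Real.sq_sqrt Real.pi_pos.le
    rw [← hp, Real.sqrt_sq (by positivity)]
    field_simp
    norm_num
  rw [e] at h
  refine h.congr' ?_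
  filter_upwards [h0, hN] with n a b
  rw [gueS_eq n _ a b]

lemma gue_final_eq (N : ℕ) (ν : ℝ) (h1 : 1 ≤ ν) (hN : ν ^ 6 = N) (x y u v : ℝ)
    (hu : u = x / (Real.sqrt 2 * ν) + Real.sqrt 2 * ν ^ 3)
    (hv : v = y / (Real.sqrt 2 * ν) + Real.sqrt 2 * ν ^ 3) :
    (((((gueH N).eval u * (Polynomial.derivative (gueH N)).eval v
      - (Polynomial.derivative (gueH N)).eval u * (gueH N).eval v)
      / (2 ^ (N + 1) * (N.factorial : ℝ)) / Real.sqrt Real.pi *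
      (Real.exp (-u ^ 2 / 2) * Real.exp (-v ^ 2 / 2)) : ℝ)) : ℂ) =
    (gueS N ν : ℝ) * (Real.exp ((x / (Real.sqrt 2 * ν)) ^ 2 / 2) *
      Real.exp ((y / (Real.sqrt 2 * ν)) ^ 2 / 2) : ℝ) *
      (((y - x) * (ν ^ 2)⁻¹ : ℝ) * (gueG N ((ν ^ 2)⁻¹) 0 x * gueG N ((ν ^ 2)⁻¹) 0 y) +
      (gueG N ((ν ^ 2)⁻¹) 0 x * gueG N ((ν ^ 2)⁻¹) 1 y -
       gueG N ((ν ^ 2)⁻¹) 1 x * gueG N ((ν ^ 2)⁻¹) 0 y)) := by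
  have hν : 0 < ν := by linarith
  have e : ((gueH N).eval u * (Polynomial.derivative (gueH N)).eval v
      - (Polynomial.derivative (gueH N)).eval u * (gueH N).eval v)
      / (2 ^ (N + 1) * (N.factorial : ℝ)) / Real.sqrt Real.pi *
      (Real.exp (-u ^ 2 / 2) * Real.exp (-v ^ 2 / 2)) =
    ((gueH N).eval u * Real.exp (-u ^ 2 / 2) *
      ((Polynomial.derivative (gueH N)).eval v * Real.exp (-v ^ 2 / 2))
      - (Polynomial.derivative (gueH N)).eval u * Real.exp (-u ^ 2 / 2) *
        ((gueH N).eval v * Real.exp (-v ^ 2 / 2)))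
      * ((2 ^ (N + 1) * (N.factorial : ℝ))⁻¹ * (Real.sqrt Real.pi)⁻¹) := by
    rw [div_eq_mul_inv, div_eq_mul_inv]; ring
  rw [e, Complex.ofReal_mul, Complex.ofReal_sub, Complex.ofReal_mul (_ * _),
    Complex.ofReal_mul (_ * _), hu, hv, gue_rep0 N ν hν hN, gue_rep0 N ν hν hN,
    gue_rep1 N ν h1 hN, gue_rep1 N ν h1 hN, gueS, div_eq_mul_inv _ (Real.sqrt Real.pi),
    div_eq_mul_inv _ (2 ^ (N + 1) * _)]
  generalize (2 ^ (N + 1) * (N.factorial : ℝ))⁻¹ = k1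
  generalize (Real.sqrt Real.pi)⁻¹ = k2
  generalize Real.exp ((x / (Real.sqrt 2 * ν)) ^ 2 / 2) = ex
  generalize Real.exp ((y / (Real.sqrt 2 * ν)) ^ 2 / 2) = ey
  generalize gueG N ((ν ^ 2)⁻¹) 0 x = g0
  generalize gueG N ((ν ^ 2)⁻¹) 1 x = g1
  generalize gueG N ((ν ^ 2)⁻¹) 0 y = f0
  generalize gueG N ((ν ^ 2)⁻¹) 1 y = f1
  generalize gueP N ν = P
  have hb : (y / (Real.sqrt 2 * ν)) = x / (Real.sqrt 2 * ν) +
      (y - x) * (ν ^ 2)⁻¹ * (ν / Real.sqrt 2) := by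
    field_simp
    ring
  rw [hb]
  generalize (y - x) * (ν ^ 2)⁻¹ = c
  generalize x / (Real.sqrt 2 * ν) = d
  generalize ν ^ 3 / Real.sqrt 2 = a
  generalize ν / Real.sqrt 2 = b
  push_cast
  ring

theorem gue_edge_scaling_limit
    (Ai : ℝ → ℝ)
    (hAi : ∀ x : ℝ, Tendsto
      (fun B : ℝ => (1 / (2 * Real.pi) : ℂ) *
        ∫ t in (-B)..B, Complex.exp (Complex.I * ((t : ℂ) ^ 3 / 3 + (t : ℂ) * (x : ℂ))))
      atTop (nhds ((Ai x : ℝ) : ℂ)))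
    (hAidiff : Differentiable ℝ Ai)
    (φ : ℕ → ℝ → ℝ) (p : ℕ → Polynomial ℝ)
    (hdeg : ∀ i, (p i).natDegree = i)
    (hlead : ∀ i, 0 < (p i).leadingCoeff)
    (hφ : ∀ i t, φ i t = (p i).eval t * Real.exp (-t ^ 2 / 2))
    (horth : ∀ i j, ∫ t : ℝ, φ i t * φ j t = if i = j then (1 : ℝ) else 0)
    (x y : ℝ) (hxy : x ≠ y) :
    Tendsto
      (fun N : ℕ =>
        (1 / (Real.sqrt 2 * (N : ℝ) ^ ((1 : ℝ) / 6))) *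
          ∑ i ∈ Finset.range N,
            φ i (x / (Real.sqrt 2 * (N : ℝ) ^ ((1 : ℝ) / 6)) + Real.sqrt (2 * N)) *
            φ i (y / (Real.sqrt 2 * (N : ℝ) ^ ((1 : ℝ) / 6)) + Real.sqrt (2 * N)))
      atTop
      (nhds ((Ai x * deriv Ai y - deriv Ai x * Ai y) / (x - y))) := by
  have hA0 := gue_airy Ai hAi
  have hA1 := gue_airy_deriv Ai hA0 hAidiff
  set ν : ℕ → ℝ := fun N => (N : ℝ) ^ ((1 : ℝ) / 6) with hνdef
  have hν6 : ∀ N, ν N ^ 6 = N := by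
    intro N
    rw [hνdef]
    simp only
    rw [← Real.rpow_natCast, ← Real.rpow_mul (by positivity)]
    norm_num
  have hν1 : ∀ᶠ N : ℕ in atTop, 1 ≤ ν N := by
    filter_upwards [eventually_ge_atTop 1] with N hN
    exact Real.one_le_rpow (by exact_mod_cast hN) (by norm_num)
  have hνt : Tendsto ν atTop atTop :=
    (tendsto_rpow_atTop (by norm_num)).comp tendsto_natCast_atTop_atTop
  have hν0 : ∀ᶠ N : ℕ in atTop, 0 < ν N := hν1.mono fun N h => by linarith
  have hε : Tendsto (fun N => (ν N ^ 2)⁻¹) atTop (nhds 0) :=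
    tendsto_inv_atTop_zero.comp ((tendsto_pow_atTop two_ne_zero).comp hνt)
  have hε0 : ∀ᶠ N : ℕ in atTop, 0 < (ν N ^ 2)⁻¹ := hν0.mono fun N h => by positivity
  have hε3 : ∀ᶠ N : ℕ in atTop, (N : ℝ) * (ν N ^ 2)⁻¹ ^ 3 = 1 := hν0.mono fun N h => by
    rw [← hν6 N]; field_simp
  have hδ : ∀ x : ℝ, Tendsto (fun N => Real.exp ((x / (Real.sqrt 2 * ν N)) ^ 2 / 2)) atTop
      (nhds 1) := by
    intro x
    have h1 : Tendsto (fun N => x / (Real.sqrt 2 * ν N)) atTop (nhds 0) :=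
      tendsto_const_nhds.div_atTop (hνt.const_mul_atTop (by positivity))
    have h2 := ((h1.pow 2).div_const 2).rexp
    simpa using h2
  have hG := fun k hk x => gueG_tendsto (fun N => (ν N ^ 2)⁻¹) hε0 hε3 hε k hk x
  have h0x := hG 0 (by norm_num) x
  have h0y := hG 0 (by norm_num) y
  have h1x := hG 1 le_rfl x
  have h1y := hG 1 le_rfl y
  have hS := gueS_tendsto ν hν0 (Eventually.of_forall hν6)
  have hlim := ((hS.ofReal).mul (((hδ x).mul (hδ y)).ofReal)).mul
    ((((hε.const_mul (y - x)).ofReal).mul (h0x.mul h0y)).add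
      ((h0x.mul h1y).sub (h1x.mul h0y)))
  have hlim2 : Tendsto (fun N : ℕ => (((x - y) * ((1 / (Real.sqrt 2 * ν N)) *
          ∑ i ∈ Finset.range N,
            φ i (x / (Real.sqrt 2 * ν N) + Real.sqrt (2 * N)) *
            φ i (y / (Real.sqrt 2 * ν N) + Real.sqrt (2 * N))) : ℝ) : ℂ)) atTop
      (nhds ((Ai x * deriv Ai y - deriv Ai x * Ai y : ℝ) : ℂ)) := by
    have e : ((Ai x * deriv Ai y - deriv Ai x * Ai y : ℝ) : ℂ) =
        (1 / (2 * Real.pi) * (1 / (2 * Real.pi)) : ℝ) * ((1 * 1 : ℝ) : ℂ) *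
        (((y - x) * 0 : ℝ) * (gueA 0 x * gueA 0 y) +
          (gueA 0 x * gueA 1 y - gueA 1 x * gueA 0 y)) := by
      push_cast
      rw [hA0, hA0, hA1, hA1]
      ring
    rw [e]
    refine hlim.congr' ?_
    filter_upwards [hν1] with N h1
    have hs : Real.sqrt (2 * N) = Real.sqrt 2 * ν N ^ 3 := by
      rw [Real.sqrt_mul (by norm_num), ← hν6 N, show ν N ^ 6 = (ν N ^ 3) ^ 2 by ring,
        Real.sqrt_sq (by positivity)]
    rw [hs]
    have hk := gue_final_eq N (ν N) h1 (hν6 N) x y _ _ rfl rfl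
    rw [← gue_kernel φ p hdeg hlead hφ horth] at hk
    refine hk.symm.trans ?_
    congr 1
    have : 0 < ν N := by linarith
    rw [← mul_assoc]
    congr 1
    field_simp
    ring
  have hlim3 := (Complex.continuous_re.tendsto _).comp hlim2
  have hlim4 := hlim3.div_const (x - y)
  simp only [Complex.ofReal_re] at hlim4
  refine hlim4.congr fun N => ?_
  simp only [Function.comp, Complex.ofReal_re]
  rw [mul_div_cancel_left₀ _ (sub_ne_zero.2 hxy)]
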